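/- Let G, H be primitive graphs and P : E_G × E_H → ℤ a payoff function. There exist N, C ∈ ℕ such that for every n ≥ N, all u, v ∈ V_H, and every p ∈ W†_n(H, u→v), the function M(p) is ℤ-valued and |M(p)(v',w') − V_n(G,H,P)| ≤ C for all v', w' ∈ V_G. -/

import Mathlib

open Filter Set

structure DirGraph (V E : Type) where
  src : E → V
  tgt : E → V

namespace DirGraph

variable {V E : Type}

/-- A (finite) walk: consecutive edges are compatible. -/
def IsWalkList (G : DirGraph V E) (p : List E) : Prop :=
  p.Chain' fun e f => G.tgt e = G.src f

/-- The set of walks of length `n`. -/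
def walks (G : DirGraph V E) (n : ℕ) : Set (List E) :=
  {p | p.length = n ∧ G.IsWalkList p}

/-- The set of walks of length `n` from `v` to `w`. -/
def walksFT (G : DirGraph V E) (n : ℕ) (v w : V) : Set (List E) :=
  {p | p.length = n ∧ G.IsWalkList p ∧
    ∃ h : p ≠ [], G.src (p.head h) = v ∧ G.tgt (p.getLast h) = w}

def IsCycle (G : DirGraph V E) (p : List E) : Prop :=
  G.IsWalkList p ∧ ∃ h : p ≠ [], G.src (p.head h) = G.tgt (p.getLast h)

def Irreducible (G : DirGraph V E) : Prop :=
  ∀ v w : V, ∃ n : ℕ, (G.walksFT n v w).Nonempty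

/-- Irreducible and the gcd of all cycle lengths is 1 (every common divisor of
the cycle lengths equals 1). -/
def Primitive (G : DirGraph V E) : Prop :=
  G.Irreducible ∧ ∀ d : ℕ, (∀ p, G.IsCycle p → d ∣ p.length) → d = 1

end DirGraph

/-- `Σ_i P(q_i, p_i)`. -/
def payoffSum {EG EH : Type} (P : EG → EH → ℤ) (q : List EG) (p : List EH) : ℤ :=
  (List.zipWith P q p).sum

/-- `V_n(G,H,P) = max_{p ∈ W_n(H)} min_{q ∈ W_n(G)} Σ P(q_i,p_i)`. -/
noncomputable def Vn {VG EG VH EH : Type} (G : DirGraph VG EG) (H : DirGraph VH EH)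
    (P : EG → EH → ℤ) (n : ℕ) : ℤ :=
  sSup ((fun p => sInf ((fun q => payoffSum P q p) '' G.walks n)) '' H.walks n)

/-- `M(p)(v,w) = inf {Σ P(q_i,p_i) : q ∈ W_n(G, v → w)}`, with `inf ∅ = ⊤`. -/
noncomputable def Mfun {VG EG EH : Type} (G : DirGraph VG EG) (P : EG → EH → ℤ)
    (p : List EH) : VG → VG → WithTop ℤ :=
  fun v w => sInf ((fun q => ((payoffSum P q p : ℤ) : WithTop ℤ)) '' G.walksFT p.length v w)

/-- `f < g` pointwise everywhere. -/
def StrictDom {V α : Type} [LT α] (f g : V → V → α) : Prop := ∀ v w, f v w < g v w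

/-- `<`-maximal elements of a set w.r.t. a strict domination relation. -/
def maxElems {α : Type} (lt : α → α → Prop) (A : Set α) : Set α :=
  {f ∈ A | ¬ ∃ g ∈ A, lt f g}

/-- Tropical convolution on `(ℤ ∪ {∞})`-valued matrices. -/
noncomputable def tconv {V : Type} (f g : V → V → WithTop ℤ) : V → V → WithTop ℤ :=
  fun u w => sInf (Set.range fun v => f u v + g v w)

/-- Tropical convolution on `ℤ`-valued matrices. -/
noncomputable def tconvZ {V : Type} (f g : V → V → ℤ) : V → V → ℤ :=
  fun u w => sInf (Set.range fun v => f u v + g v w)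

/-- Non-improvable walks in `H` (of any length). -/
noncomputable def walksDagger {VG EG VH EH : Type} (G : DirGraph VG EG) (H : DirGraph VH EH)
    (P : EG → EH → ℤ) : Set (List EH) :=
  {p | ∃ u v : VH, p ∈ H.walksFT p.length u v ∧
    Mfun G P p ∈ maxElems StrictDom (Mfun G P '' H.walksFT p.length u v)}

/-- The edge shift of a graph. -/
def XEdge {V E : Type} (G : DirGraph V E) : Set (ℤ → E) :=
  {x | ∀ n : ℤ, G.tgt (x n) = G.src (x (n + 1))}

/-- The word `x_{[m,n]}` as a list (of length `n - m + 1` when `m ≤ n`). -/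
def seg {A : Type} (x : ℤ → A) (m n : ℤ) : List A :=
  List.ofFn fun i : Fin (n + 1 - m).toNat => x (m + i)

/-- `X_H^†`: points all of whose subwords are non-improvable walks. -/
noncomputable def XHdag {VG EG VH EH : Type} (G : DirGraph VG EG) (H : DirGraph VH EH)
    (P : EG → EH → ℤ) : Set (ℤ → EH) :=
  {x | x ∈ XEdge H ∧ ∀ m n : ℤ, m ≤ n → seg x m n ∈ walksDagger G H P}

/-- `R(p)`: optimal responses to `p`. -/
noncomputable def Rset {VG EG EH : Type} (G : DirGraph VG EG) (P : EG → EH → ℤ)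
    (p : List EH) : Set (List EG) :=
  {q | ∃ v w : VG, q ∈ G.walksFT p.length v w ∧
    ((payoffSum P q p : ℤ) : WithTop ℤ) = Mfun G P p v w}

namespace DirGraph

variable {V E : Type} {G : DirGraph V E}

theorem exists_mem_walksFT {n : ℕ} {p : List E} (hp : p ∈ G.walks n) (hn : n ≠ 0) :
    ∃ v w, p ∈ G.walksFT n v w := by
  obtain ⟨rfl, hw⟩ := hp
  exact ⟨_, _, rfl, hw, List.ne_nil_of_length_pos (Nat.pos_of_ne_zero hn), rfl, rfl⟩

theorem mem_walks_of_mem_walksFT {n : ℕ} {v w : V} {p : List E} (hp : p ∈ G.walksFT n v w) :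
    p ∈ G.walks n :=
  ⟨hp.1, hp.2.1⟩

theorem append_mem_walksFT {m n : ℕ} {u v w : V} {p q : List E}
    (hp : p ∈ G.walksFT m u v) (hq : q ∈ G.walksFT n v w) : p ++ q ∈ G.walksFT (m + n) u w := by
  obtain ⟨rfl, hpw, hp0, rfl, rfl⟩ := hp
  obtain ⟨rfl, hqw, hq0, hqs, rfl⟩ := hq
  refine ⟨List.length_append, ?_, by simp [hp0], by simp [hp0], by simp [hq0]⟩
  refine List.isChain_append.2 ⟨hpw, hqw, fun x hx y hy => ?_⟩
  rw [List.getLast?_eq_some_getLast hp0, Option.mem_some_iff] at hx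
  rw [List.head?_eq_some_head hq0, Option.mem_some_iff] at hy
  rw [← hx, ← hy, hqs]

theorem exists_split_of_append_mem_walksFT {n : ℕ} {u w : V} {p q : List E}
    (hp0 : p ≠ []) (hq0 : q ≠ []) (h : p ++ q ∈ G.walksFT n u w) :
    ∃ v, p ∈ G.walksFT p.length u v ∧ q ∈ G.walksFT q.length v w := by
  obtain ⟨-, hw, _, hs, ht⟩ := h
  obtain ⟨hpw, hqw, hpq⟩ := List.isChain_append.1 hw
  refine ⟨G.tgt (p.getLast hp0), ⟨rfl, hpw, hp0, ?_, rfl⟩, ⟨rfl, hqw, hq0, ?_, ?_⟩⟩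
  · simpa [List.head_append, hp0] using hs
  · exact (hpq _ (List.getLast?_eq_some_getLast hp0) _ (List.head?_eq_some_head hq0)).symm
  · simpa [List.getLast_append, hq0] using ht

theorem IsCycle.exists_mem_walksFT {p : List E} (hp : G.IsCycle p) :
    ∃ v, p ∈ G.walksFT p.length v v := by
  obtain ⟨hw, h0, h⟩ := hp
  exact ⟨_, rfl, hw, h0, rfl, h.symm⟩

theorem Primitive.nonempty {G : DirGraph V E} (hG : G.Primitive) : Nonempty V := by
  by_contra hV
  rw [not_nonempty_iff] at hV
  exact zero_ne_one (hG.2 0 fun p hp => hV.elim hp.exists_mem_walksFT.choose)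

/-- The lengths of closed walks at a vertex, together with `0`. -/
def closedWalkLengths (G : DirGraph V E) (v : V) : AddSubmonoid ℕ where
  carrier := {n | n = 0 ∨ (G.walksFT n v v).Nonempty}
  zero_mem' := Or.inl rfl
  add_mem' := by
    rintro a b (rfl | ⟨p, hp⟩) (rfl | ⟨q, hq⟩)
    · exact Or.inl rfl
    · exact Or.inr ⟨q, by simpa using hq⟩
    · exact Or.inr ⟨p, hp⟩
    · exact Or.inr ⟨p ++ q, append_mem_walksFT hp hq⟩

theorem Primitive.setGcd_closedWalkLengths (hG : G.Primitive) (v : V) :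
    Nat.setGcd (G.closedWalkLengths v : Set ℕ) = 1 := by
  refine hG.2 _ fun p hp => ?_
  obtain ⟨w, hw⟩ := hp.exists_mem_walksFT
  obtain ⟨a, x, hx⟩ := hG.1 v w
  obtain ⟨b, y, hy⟩ := hG.1 w v
  have h₁ : a + b ∈ (G.closedWalkLengths v : Set ℕ) := Or.inr ⟨_, append_mem_walksFT hx hy⟩
  have h₂ : a + p.length + b ∈ (G.closedWalkLengths v : Set ℕ) :=
    Or.inr ⟨_, append_mem_walksFT (append_mem_walksFT hx hw) hy⟩
  have h₃ : a + p.length + b = a + b + p.length := by omega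
  rw [h₃] at h₂
  exact (Nat.dvd_add_right (Nat.setGcd_dvd_of_mem h₁)).1 (Nat.setGcd_dvd_of_mem h₂)

theorem Primitive.exists_forall_walksFT_nonempty [Finite V] (hG : G.Primitive) :
    ∃ K : ℕ, ∀ n ≥ K, ∀ v w : V, (G.walksFT n v w).Nonempty := by
  have key : ∀ v w : V, ∃ K : ℕ, ∀ n ≥ K, (G.walksFT n v w).Nonempty := fun v w => by
    obtain ⟨N, hN⟩ := Nat.exists_mem_closure_of_ge (G.closedWalkLengths v : Set ℕ)
    obtain ⟨a, x, hx⟩ := hG.1 v w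
    refine ⟨N + a, fun n hn => ?_⟩
    have hmem := hN (n - a) (by omega) (by simp [hG.setGcd_closedWalkLengths v])
    rw [AddSubmonoid.closure_eq] at hmem
    obtain h | ⟨y, hy⟩ := hmem
    · exact ⟨x, by rwa [show n = a by omega]⟩
    · exact ⟨y ++ x, by simpa [show n - a + a = n by omega] using append_mem_walksFT hy hx⟩
  choose K hK using key
  obtain ⟨M, hM⟩ := Finite.exists_le fun x : V × V => K x.1 x.2
  exact ⟨M, fun n hn v w => hK v w n ((hM (v, w)).trans hn)⟩

theorem finite_walks [Finite E] (G : DirGraph V E) (n : ℕ) : (G.walks n).Finite :=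
  (List.finite_length_eq E n).subset fun _ hp => hp.1

/-- If `K`-step walks join all pairs of vertices, a long walk can be rerouted between any two
endpoints by changing only its first and last `K` edges. -/
theorem exists_reroute {K n : ℕ} (hK : ∀ v w : V, (G.walksFT K v w).Nonempty) (hn : 2 * K < n)
    {q : List E} (hq : q ∈ G.walks n) (a b : V) :
    ∃ x r y x' y' : List E, q = x ++ (r ++ y) ∧ x' ++ (r ++ y') ∈ G.walksFT n a b ∧
      x.length = K ∧ x'.length = K ∧ y.length = K ∧ y'.length = K := by
  have hK0 : 0 < K := by
    obtain ⟨p, rfl, -, h, -⟩ := hK a b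
    exact List.length_pos_of_ne_nil h
  obtain ⟨v, w, hvw⟩ := exists_mem_walksFT hq (by omega)
  have hlen := hq.1
  have hx : (q.take K).length = K := by simp; omega
  have hd : (q.drop K).length = n - K := by simp [hlen]
  have hr : ((q.drop K).take (n - 2 * K)).length = n - 2 * K := by simp; omega
  have hy : ((q.drop K).drop (n - 2 * K)).length = K := by simp; omega
  have hqe : q = q.take K ++ ((q.drop K).take (n - 2 * K) ++ (q.drop K).drop (n - 2 * K)) := by
    rw [List.take_append_drop, List.take_append_drop]
  generalize q.take K = x at *
  generalize (q.drop K).take (n - 2 * K) = r at *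
  generalize (q.drop K).drop (n - 2 * K) = y at *
  have ne {l : List E} {k : ℕ} (h : l.length = k) (hk : 0 < k) : l ≠ [] :=
    List.ne_nil_of_length_pos (h ▸ hk)
  rw [hqe] at hvw
  have hr0 : r ≠ [] := ne hr (by omega)
  obtain ⟨c, -, h₁⟩ := exists_split_of_append_mem_walksFT (ne hx hK0) (by simp [hr0]) hvw
  obtain ⟨d, h₂, -⟩ := exists_split_of_append_mem_walksFT hr0 (ne hy hK0) h₁
  obtain ⟨x', hx'⟩ := hK a c
  obtain ⟨y', hy'⟩ := hK d b
  refine ⟨x, r, y, x', y', hqe, ?_, hx, hx'.1, hy, hy'.1⟩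
  have h := append_mem_walksFT hx' (append_mem_walksFT h₂ hy')
  rwa [hr, show K + (n - 2 * K + K) = n by omega] at h

end DirGraph

section Payoff

variable {EG EH : Type} {P : EG → EH → ℤ} {B : ℤ}

theorem payoffSum_flip (P : EG → EH → ℤ) (q : List EG) (p : List EH) :
    payoffSum (fun f e => P e f) p q = payoffSum P q p := by
  rw [payoffSum, payoffSum, List.zipWith_comm]


theorem abs_payoffSum_le (hB0 : 0 ≤ B) (hB : ∀ e f, |P e f| ≤ B) (q : List EG) (p : List EH) :
    |payoffSum P q p| ≤ B * q.length := by
  induction q generalizing p with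
  | nil => simp [payoffSum]
  | cons e q ih =>
    cases p with
    | nil => simp only [payoffSum, List.zipWith_nil_right, List.sum_nil, abs_zero]; positivity
    | cons f p =>
      have h₁ := ih p
      have h₂ := hB e f
      simp only [payoffSum, List.zipWith_cons_cons, List.sum_cons, List.length_cons] at h₁ ⊢
      push_cast
      refine (abs_add_le _ _).trans ?_
      linarith

theorem payoffSum_append (P : EG → EH → ℤ) (x r : List EG) (p : List EH) :
    payoffSum P (x ++ r) p = payoffSum P x (p.take x.length) + payoffSum P r (p.drop x.length) := by
  induction x generalizing p with
  | nil => simp [payoffSum]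
  | cons e x ih =>
    cases p with
    | nil => simp [payoffSum]
    | cons f p =>
      have h := ih p
      simp only [payoffSum] at h
      simp [payoffSum, h, add_assoc]

/-- Changing the first and last `K` terms of one argument changes the payoff by at most `4 K B`. -/
theorem abs_payoffSum_sub_le (hB0 : 0 ≤ B) (hB : ∀ e f, |P e f| ≤ B) {K : ℕ}
    {x r y x' y' : List EG} (hx : x.length = K) (hx' : x'.length = K) (hy : y.length = K)
    (hy' : y'.length = K) (p : List EH) :
    |payoffSum P (x' ++ (r ++ y')) p - payoffSum P (x ++ (r ++ y)) p| ≤ 4 * (B * K) := by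
  simp only [payoffSum_append, hx, hx']
  have h₁ := abs_le.1 (abs_payoffSum_le hB0 hB x (p.take K))
  have h₂ := abs_le.1 (abs_payoffSum_le hB0 hB x' (p.take K))
  have h₃ := abs_le.1 (abs_payoffSum_le hB0 hB y ((p.drop K).drop r.length))
  have h₄ := abs_le.1 (abs_payoffSum_le hB0 hB y' ((p.drop K).drop r.length))
  rw [hx] at h₁
  rw [hx'] at h₂
  rw [hy] at h₃
  rw [hy'] at h₄
  rw [abs_le]
  constructor <;> linarith [h₁.1, h₁.2, h₂.1, h₂.2, h₃.1, h₃.2, h₄.1, h₄.2]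

theorem exists_payoff_bound [Finite EG] [Finite EH] (P : EG → EH → ℤ) :
    ∃ B : ℕ, ∀ e f, |P e f| ≤ (B : ℤ) := by
  obtain ⟨B, hB⟩ := Finite.exists_le fun x : EG × EH => (P x.1 x.2).natAbs
  exact ⟨B, fun e f => by rw [Int.abs_eq_natAbs]; exact_mod_cast hB (e, f)⟩

end Payoff

section Value

variable {VG EG VH EH : Type} (G : DirGraph VG EG) (P : EG → EH → ℤ)

/-- The cost `min_{q ∈ W_n(G)} Σ P(q_i, p_i)` of an optimal response to `p`. -/
noncomputable def minPayoff (n : ℕ) (p : List EH) : ℤ :=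
  sInf ((fun q => payoffSum P q p) '' G.walks n)

theorem minPayoff_le_Vn [Finite EH] (H : DirGraph VH EH) {n : ℕ} {p : List EH}
    (hp : p ∈ H.walks n) : minPayoff G P n p ≤ Vn G H P n :=
  le_csSup ((H.finite_walks n).image _).bddAbove ⟨p, hp, rfl⟩

theorem exists_minPayoff_eq_Vn [Finite EH] (H : DirGraph VH EH) {n : ℕ}
    (hn : (H.walks n).Nonempty) : ∃ p ∈ H.walks n, minPayoff G P n p = Vn G H P n :=
  (hn.image _).csSup_mem ((H.finite_walks n).image _)

variable [Finite EG]

theorem minPayoff_le {n : ℕ} (p : List EH) {q : List EG} (hq : q ∈ G.walks n) :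
    minPayoff G P n p ≤ payoffSum P q p :=
  csInf_le ((G.finite_walks n).image _).bddBelow ⟨q, hq, rfl⟩

theorem exists_payoffSum_eq_minPayoff {n : ℕ} (hn : (G.walks n).Nonempty) (p : List EH) :
    ∃ q ∈ G.walks n, payoffSum P q p = minPayoff G P n p :=
  (hn.image _).csInf_mem ((G.finite_walks n).image _)

theorem Mfun_eq_coe {p : List EH} {v w : VG} (h : (G.walksFT p.length v w).Nonempty) :
    ∃ q ∈ G.walksFT p.length v w, Mfun G P p v w = (payoffSum P q p : ℤ) ∧
      ∀ q' ∈ G.walksFT p.length v w, payoffSum P q p ≤ payoffSum P q' p := by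
  have hfin : (G.walksFT p.length v w).Finite :=
    (G.finite_walks _).subset fun _ => DirGraph.mem_walks_of_mem_walksFT
  obtain ⟨q, hq, hmin⟩ := hfin.exists_minimalFor (fun q => payoffSum P q p) _ h
  have hle : ∀ q' ∈ G.walksFT p.length v w, payoffSum P q p ≤ payoffSum P q' p := fun q' hq' =>
    (le_total _ _).elim id fun h => hmin hq' h
  refine ⟨q, hq, IsLeast.csInf_eq ⟨⟨q, hq, rfl⟩, ?_⟩, hle⟩
  rintro _ ⟨q', hq', rfl⟩
  exact WithTop.coe_le_coe.2 (hle q' hq')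

variable {G P} {B : ℕ}

/-- When `K`-step walks join all vertices of `G`, every entry of `M(p)` is finite and within
`4 K B` of the unconstrained minimum. -/
theorem exists_Mfun_eq_and_near_minPayoff (hB : ∀ e f, |P e f| ≤ (B : ℤ)) {K n : ℕ}
    (hK : ∀ n ≥ K, ∀ v w : VG, (G.walksFT n v w).Nonempty) (hn : 2 * K < n) {p : List EH}
    (hp : p.length = n) (a b : VG) :
    ∃ z : ℤ, Mfun G P p a b = z ∧ minPayoff G P n p ≤ z ∧
      z ≤ minPayoff G P n p + 4 * (B * K) := by
  subst hp
  have hne := hK p.length (by omega) a b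
  obtain ⟨q, hq, heq, hmin⟩ := Mfun_eq_coe G P hne
  refine ⟨_, heq, minPayoff_le G P p (DirGraph.mem_walks_of_mem_walksFT hq), ?_⟩
  obtain ⟨q₀, hq₀, hq₀min⟩ := exists_payoffSum_eq_minPayoff G P
    (hne.mono fun _ => DirGraph.mem_walks_of_mem_walksFT) p
  obtain ⟨x, r, y, x', y', rfl, hmem, hx, hx', hy, hy'⟩ :=
    DirGraph.exists_reroute (hK K le_rfl) hn hq₀ a b
  have h₁ := abs_le.1 (abs_payoffSum_sub_le (r := r) (by positivity) hB hx hx' hy hy' p)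
  linarith [h₁.2, hmin _ hmem]

/-- When `L`-step walks join all vertices of `H`, any endpoints admit a walk whose optimal
response costs at least `V_n - 4 L B`. -/
theorem exists_walk_Vn_le [Finite EH] {H : DirGraph VH EH} (hB : ∀ e f, |P e f| ≤ (B : ℤ))
    {L n : ℕ} (hL : ∀ n ≥ L, ∀ v w : VH, (H.walksFT n v w).Nonempty) (hn : 2 * L < n)
    (hGn : (G.walks n).Nonempty) (u v : VH) :
    ∃ p ∈ H.walksFT n u v, Vn G H P n ≤ minPayoff G P n p + 4 * (B * L) := by
  obtain ⟨p, hp, hpV⟩ := exists_minPayoff_eq_Vn G P H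
    ((hL n (by omega) u v).mono fun _ => DirGraph.mem_walks_of_mem_walksFT)
  obtain ⟨x, r, y, x', y', rfl, hmem, hx, hx', hy, hy'⟩ :=
    DirGraph.exists_reroute (hL L le_rfl) hn hp u v
  refine ⟨_, hmem, ?_⟩
  obtain ⟨q, hq, hqmin⟩ := exists_payoffSum_eq_minPayoff G P hGn (x' ++ (r ++ y'))
  have h := abs_le.1 (abs_payoffSum_sub_le (P := fun f e => P e f) (r := r) (by positivity)
    (fun f e => hB e f) hx hx' hy hy' q)
  rw [payoffSum_flip P, payoffSum_flip P] at h
  linarith [h.1, minPayoff_le G P (x ++ (r ++ y)) hq]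

end Value

/-- For primitive `G, H` there are `N, C` such that for `n ≥ N` every non-improvable
walk `p` has `M(p)` `ℤ`-valued within distance `C` of `V_n(G,H,P)`. -/
theorem non_improvable_almost_optimal {VG EG VH EH : Type} [Fintype VG] [Fintype EG]
    [Fintype VH] [Fintype EH] (G : DirGraph VG EG) (H : DirGraph VH EH)
    (hG : G.Primitive) (hH : H.Primitive) (P : EG → EH → ℤ) :
    ∃ N C : ℕ, ∀ n ≥ N, ∀ u v : VH, ∀ p ∈ H.walksFT n u v,
      Mfun G P p ∈ maxElems StrictDom (Mfun G P '' H.walksFT n u v) →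
      ∃ mz : VG → VG → ℤ,
        (∀ a b : VG, Mfun G P p a b = (mz a b : WithTop ℤ)) ∧
        ∀ a b : VG, |mz a b - Vn G H P n| ≤ (C : ℤ) := by
  obtain ⟨K, hK⟩ := hG.exists_forall_walksFT_nonempty
  obtain ⟨L, hL⟩ := hH.exists_forall_walksFT_nonempty
  obtain ⟨B, hB⟩ := exists_payoff_bound P
  obtain ⟨a₀⟩ := hG.nonempty
  refine ⟨2 * K + 2 * L + 1, 4 * (B * K) + 4 * (B * L), fun n hn u v p hp hmax => ?_⟩
  have near {p' : List EH} (hp' : p' ∈ H.walksFT n u v) (a b : VG) :=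
    exists_Mfun_eq_and_near_minPayoff hB hK (by omega) hp'.1 a b
  choose mz hmz hlo hhi using near hp
  refine ⟨mz, hmz, fun a b => ?_⟩
  obtain ⟨p', hp', hV⟩ := exists_walk_Vn_le hB hL (by omega : 2 * L < n)
    ((hK n (by omega) a₀ a₀).mono fun _ => DirGraph.mem_walks_of_mem_walksFT) u v
  have hle : ∃ c d, minPayoff G P n p' ≤ mz c d := by
    by_contra! hlt
    refine hmax.2 ⟨_, ⟨p', hp', rfl⟩, fun c d => ?_⟩
    obtain ⟨z, hz, hz', -⟩ := near hp' c d
    rw [hmz, hz]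
    exact_mod_cast (hlt c d).trans_le hz'
  obtain ⟨c, d, hcd⟩ := hle
  have hpV := minPayoff_le_Vn G P H (DirGraph.mem_walks_of_mem_walksFT hp)
  have hBL : (0 : ℤ) ≤ B * L := by positivity
  push_cast
  rw [abs_le]
  constructor <;> linarith [hlo a b, hhi a b, hhi c d]
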